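/- For every ε > 0 there exists N such that for all n ≥ N, the number of strictly metric path systems on the vertex set [n] is at most 2^{(1.38+ε)n²}. -/

import Mathlib

open SimpleGraph

/-- A path system on a simple graph `G`: for every pair of distinct vertices a chosen
simple path between them, with `P_{u,v} = P_{v,u}`. -/
structure PathSystem {V : Type*} (G : SimpleGraph V) where
  path : ∀ u v : V, u ≠ v → G.Path u v
  symm : ∀ (u v : V) (h : u ≠ v), (path v u (Ne.symm h)).val = (path u v h).val.reverse

namespace PathSystem

variable {V : Type*} {G : SimpleGraph V}

/-- A path system is consistent if whenever `a` lies on `P_{u,v}`, the path `P_{u,v}` is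
the concatenation of `P_{u,a}` and `P_{a,v}`. -/
def Consistent (P : PathSystem G) : Prop :=
  ∀ (u v : V) (huv : u ≠ v) (a : V) (hua : u ≠ a) (hav : a ≠ v),
    a ∈ (P.path u v huv).val.support →
      (P.path u v huv).val = (P.path u a hua).val.append (P.path a v hav).val

/-- A path system is neighborly if the chosen path between the endpoints of each edge is
that single edge. -/
def Neighborly (P : PathSystem G) : Prop :=
  ∀ (u v : V) (h : G.Adj u v),
    (P.path u v h.ne).val = SimpleGraph.Walk.cons h SimpleGraph.Walk.nil

/-- The `w`-weight of a walk: the sum of the weights of its edges. -/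
def wlen (w : Sym2 V → ℝ) {u v : V} (Q : G.Walk u v) : ℝ :=
  (Q.edges.map w).sum

/-- A path system is metric if for some positive edge weights every chosen path is a
shortest path between its endpoints. -/
def Metric (P : PathSystem G) : Prop :=
  ∃ w : Sym2 V → ℝ, (∀ e ∈ G.edgeSet, 0 < w e) ∧
    ∀ (u v : V) (h : u ≠ v) (Q : G.Path u v),
      wlen w (P.path u v h).val ≤ wlen w Q.val

/-- A path system is strictly metric if for some positive edge weights every chosen path
is the unique shortest path between its endpoints. -/
def StrictlyMetric (P : PathSystem G) : Prop :=
  ∃ w : Sym2 V → ℝ, (∀ e ∈ G.edgeSet, 0 < w e) ∧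
    ∀ (u v : V) (h : u ≠ v) (Q : G.Path u v), Q ≠ P.path u v h →
      wlen w (P.path u v h).val < wlen w Q.val

end PathSystem

namespace PathSystem

section Weights

variable {V : Type*} {G : SimpleGraph V} {w : Sym2 V → ℝ}

theorem wlen_append {u v x : V} (p : G.Walk u v) (q : G.Walk v x) :
    wlen w (p.append q) = wlen w p + wlen w q := by
  simp [wlen]

theorem wlen_reverse {u v : V} (p : G.Walk u v) : wlen w p.reverse = wlen w p := by
  simp [wlen, List.sum_reverse]

theorem wlen_cons {u v x : V} (h : G.Adj u v) (p : G.Walk v x) :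
    wlen w (Walk.cons h p) = w s(u, v) + wlen w p := by
  simp [wlen]

theorem wlen_nonneg (hw : ∀ e ∈ G.edgeSet, 0 < w e) {u v : V} (p : G.Walk u v) :
    0 ≤ wlen w p := by
  refine List.sum_nonneg fun x hx => ?_
  obtain ⟨e, he, rfl⟩ := List.mem_map.1 hx
  exact (hw e (p.edges_subset_edgeSet he)).le

variable [DecidableEq V]

theorem wlen_bypass_lt_or_eq (hw : ∀ e ∈ G.edgeSet, 0 < w e) {u v : V} (p : G.Walk u v) :
    wlen w p.bypass < wlen w p ∨ p.bypass = p := by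
  induction p with
  | nil => exact Or.inr rfl
  | @cons u x v h p ih =>
    have hpos : 0 < w s(u, x) := hw _ h
    have hle : wlen w p.bypass ≤ wlen w p := by
      rcases ih with ih | ih
      · exact ih.le
      · rw [ih]
    rw [wlen_cons]
    by_cases hs : u ∈ p.bypass.support
    · left
      rw [Walk.bypass, dif_pos hs]
      have hsplit := wlen_append (w := w) (p.bypass.takeUntil u hs) (p.bypass.dropUntil u hs)
      rw [Walk.take_spec] at hsplit
      linarith [wlen_nonneg hw (p.bypass.takeUntil u hs)]
    · rw [Walk.bypass, dif_neg hs, wlen_cons]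
      rcases ih with ih | ih
      · left; linarith
      · right; rw [ih]

/-- The distance induced by a path system and a weight function. -/
def pdist (P : PathSystem G) (w : Sym2 V → ℝ) (u v : V) : ℝ :=
  if h : u = v then 0 else wlen w (P.path u v h).val

theorem pdist_self (P : PathSystem G) (w : Sym2 V → ℝ) (u : V) : P.pdist w u u = 0 := by
  simp [pdist]

theorem pdist_of_ne (P : PathSystem G) (w : Sym2 V → ℝ) {u v : V} (h : u ≠ v) :
    P.pdist w u v = wlen w (P.path u v h).val := by
  simp [pdist, h]

theorem pdist_comm (P : PathSystem G) (w : Sym2 V → ℝ) (u v : V) :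
    P.pdist w u v = P.pdist w v u := by
  by_cases h : u = v
  · rw [h]
  · rw [pdist_of_ne _ _ h, pdist_of_ne _ _ (Ne.symm h), P.symm u v h, wlen_reverse]

/-- `w` witnesses that the path system `P` is strictly metric. -/
def IsStrictWeight (P : PathSystem G) (w : Sym2 V → ℝ) : Prop :=
  (∀ e ∈ G.edgeSet, 0 < w e) ∧
    ∀ (u v : V) (h : u ≠ v) (Q : G.Path u v), Q ≠ P.path u v h →
      wlen w (P.path u v h).val < wlen w Q.val

variable {P Q : PathSystem G}

theorem IsStrictWeight.wlen_le (hw : P.IsStrictWeight w) {u v : V} (h : u ≠ v)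
    (p : G.Path u v) : wlen w (P.path u v h).val ≤ wlen w p.val := by
  by_cases hp : p = P.path u v h
  · rw [hp]
  · exact (hw.2 u v h p hp).le

theorem IsStrictWeight.pdist_lt (hw : P.IsStrictWeight w) {u v : V} (h : u ≠ v) {a : V}
    (ha : a ∉ (P.path u v h).val.support) :
    P.pdist w u v < P.pdist w u a + P.pdist w a v := by
  have hua : u ≠ a := by
    rintro rfl
    exact ha (Walk.start_mem_support _)
  have hav : a ≠ v := by
    rintro rfl
    exact ha (Walk.end_mem_support _)
  rw [pdist_of_ne _ _ h, pdist_of_ne _ _ hua, pdist_of_ne _ _ hav, ← wlen_append]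
  set W := (P.path u a hua).val.append (P.path a v hav).val with hW
  have hle : wlen w (P.path u v h).val ≤ wlen w W.bypass :=
    hw.wlen_le h ⟨W.bypass, W.bypass_isPath⟩
  rcases wlen_bypass_lt_or_eq hw.1 W with hlt | heq
  · exact hle.trans_lt hlt
  · have hpath : W.IsPath := heq ▸ W.bypass_isPath
    refine hw.2 u v h ⟨W, hpath⟩ fun hP => ha ?_
    rw [← hP]
    simp [hW, Walk.mem_support_append_iff]

theorem IsStrictWeight.consistent (hw : P.IsStrictWeight w) : P.Consistent := by
  intro u v h a hua hav ha
  have hsplit := Walk.take_spec (P.path u v h).val ha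
  set p := (P.path u v h).val.takeUntil a ha with hp
  set q := (P.path u v h).val.dropUntil a ha with hq
  have hpp : p.IsPath := (P.path u v h).property.takeUntil ha
  have hqp : q.IsPath := (P.path u v h).property.dropUntil ha
  have hsum : wlen w (P.path u v h).val = wlen w p + wlen w q := by
    rw [← wlen_append, hsplit]
  have hp_le := hw.wlen_le hua ⟨p, hpp⟩
  have hq_le := hw.wlen_le hav ⟨q, hqp⟩
  have htri : wlen w (P.path u v h).val ≤
      wlen w (P.path u a hua).val + wlen w (P.path a v hav).val := by
    rw [← wlen_append]
    set W := (P.path u a hua).val.append (P.path a v hav).val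
    refine (hw.wlen_le h ⟨W.bypass, W.bypass_isPath⟩).trans ?_
    rcases wlen_bypass_lt_or_eq hw.1 W with hlt | heq
    · exact hlt.le
    · exact (congrArg (wlen w) heq).le
  have hp_eq : (⟨p, hpp⟩ : G.Path u a) = P.path u a hua := by
    by_contra hne
    have hlt := hw.2 u a hua _ hne
    dsimp only at hlt hp_le hq_le
    linarith
  have hq_eq : (⟨q, hqp⟩ : G.Path a v) = P.path a v hav := by
    by_contra hne
    have hlt := hw.2 a v hav _ hne
    dsimp only at hlt hp_le hq_le
    linarith
  rw [← hp_eq, ← hq_eq, hsplit]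

theorem IsStrictWeight.pdist_eq (hw : P.IsStrictWeight w) {u v : V} (h : u ≠ v) {a : V}
    (ha : a ∈ (P.path u v h).val.support) :
    P.pdist w u v = P.pdist w u a + P.pdist w a v := by
  by_cases hua : u = a
  · subst hua
    rw [pdist_self, zero_add]
  by_cases hav : a = v
  · subst hav
    rw [pdist_self, add_zero]
  rw [pdist_of_ne _ _ h, pdist_of_ne _ _ hua, pdist_of_ne _ _ hav, ← wlen_append,
    ← hw.consistent u v h a hua hav ha]

end Weights

section Midpoints

variable {V : Type*} {G : SimpleGraph V}

/-- An interior vertex of the chosen path, or its first vertex if there is none. -/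
noncomputable def mid (P : PathSystem G) (u v : V) (h : u ≠ v) : V :=
  open Classical in
  if hc : ∃ c ∈ (P.path u v h).val.support, u ≠ c ∧ c ≠ v then hc.choose else u

theorem mid_mem (P : PathSystem G) (u v : V) (h : u ≠ v) :
    P.mid u v h ∈ (P.path u v h).val.support := by
  unfold mid
  split_ifs with hc
  · exact hc.choose_spec.1
  · exact Walk.start_mem_support _

theorem mid_ne (P : PathSystem G) {u v : V} {h : u ≠ v}
    (hc : ∃ c ∈ (P.path u v h).val.support, u ≠ c ∧ c ≠ v) :
    u ≠ P.mid u v h ∧ P.mid u v h ≠ v := by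
  unfold mid
  rw [dif_pos hc]
  exact hc.choose_spec.2

theorem path_eq_of_no_interior {u v : V} (h : u ≠ v) (p q : G.Path u v)
    (hp : ¬ ∃ c ∈ p.val.support, u ≠ c ∧ c ≠ v)
    (hq : ¬ ∃ c ∈ q.val.support, u ≠ c ∧ c ≠ v) : p = q := by
  have key : ∀ r : G.Path u v, (¬ ∃ c ∈ r.val.support, u ≠ c ∧ c ≠ v) →
      ∃ hadj : G.Adj u v, r.val = Walk.cons hadj Walk.nil := by
    rintro ⟨r, hr⟩ hint
    cases r with
    | nil => exact absurd rfl h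
    | @cons _ x _ hadj r =>
      have hx : x = v := by
        by_contra hx
        exact hint ⟨x, by simp, hadj.ne, hx⟩
      subst hx
      refine ⟨hadj, ?_⟩
      obtain rfl : r = Walk.nil :=
        Walk.eq_nil_iff_nil.2 (Walk.isPath_iff_nil.1 hr.of_cons)
      rfl
  obtain ⟨_, hp'⟩ := key p hp
  obtain ⟨_, hq'⟩ := key q hq
  exact Subtype.ext (hp'.trans hq'.symm)

/-- The unordered pairs of distinct vertices. -/
abbrev VertexPair (V : Type*) := {e : Sym2 V // ¬ e.IsDiag}

theorem VertexPair.out_ne (e : VertexPair V) : (Quot.out e.1).1 ≠ (Quot.out e.1).2 := by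
  intro h
  apply e.2
  have he : s((Quot.out e.1).1, (Quot.out e.1).2) = e.1 := Quot.out_eq e.1
  rw [← he]
  exact h

/-- The designated vertex of the chosen path between the two vertices of a pair. -/
noncomputable def pairMid (P : PathSystem G) (e : VertexPair V) : V :=
  P.mid _ _ e.out_ne

/-- The chosen path between the two vertices of a pair. -/
noncomputable def pairPath (P : PathSystem G) (e : VertexPair V) :
    G.Path (Quot.out e.1).1 (Quot.out e.1).2 :=
  P.path _ _ e.out_ne

theorem path_ext_of_mid {P Q : PathSystem G} (hP : P.Consistent) (hQ : Q.Consistent)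
    (hPQ : ∀ e, P.pairMid e ∈ (Q.pairPath e).val.support)
    (hQP : ∀ e, Q.pairMid e ∈ (P.pairPath e).val.support) : P = Q := by
  have key : ∀ (k : ℕ) (u v : V) (h : u ≠ v), (P.path u v h).val.length ≤ k →
      P.path u v h = Q.path u v h := by
    intro k
    induction k with
    | zero =>
      intro u v h hk
      exact absurd (Walk.eq_of_length_eq_zero (Nat.le_zero.1 hk)) h
    | succ k ih =>
      have oriented : ∀ (e : VertexPair V), (P.pairPath e).val.length ≤ k + 1 →
          P.pairPath e = Q.pairPath e := by
        intro e hk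
        by_cases hint : ∃ c ∈ (P.pairPath e).val.support,
            (Quot.out e.1).1 ≠ c ∧ c ≠ (Quot.out e.1).2
        · obtain ⟨h₁, h₂⟩ := P.mid_ne (h := e.out_ne) hint
          have eP := hP _ _ e.out_ne _ h₁ h₂ (P.mid_mem _ _ _)
          have eQ := hQ _ _ e.out_ne _ h₁ h₂ (hPQ e)
          have hlen := congrArg Walk.length eP
          rw [Walk.length_append] at hlen
          have l₁ : (P.path _ _ h₁).val.length ≠ 0 := fun h0 =>
            h₁ (Walk.eq_of_length_eq_zero h0)
          have l₂ : (P.path _ _ h₂).val.length ≠ 0 := fun h0 =>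
            h₂ (Walk.eq_of_length_eq_zero h0)
          unfold pairPath at hk
          have i₁ := ih _ _ h₁ (by lia)
          have i₂ := ih _ _ h₂ (by lia)
          rw [i₁, i₂, ← eQ] at eP
          exact Subtype.ext eP
        · refine path_eq_of_no_interior e.out_ne _ _ hint fun hint' => ?_
          exact hint ⟨_, hQP e, Q.mid_ne (h := e.out_ne) hint'⟩
      intro u v h hk
      let e : VertexPair V := ⟨s(u, v), fun hd => h hd⟩
      have he : s((Quot.out e.1).1, (Quot.out e.1).2) = s(u, v) := Quot.out_eq e.1
      have ho := oriented e
      unfold pairPath at ho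
      generalize e.out_ne = hne at ho
      generalize (Quot.out e.1).1 = a at he hne ho
      generalize (Quot.out e.1).2 = b at he hne ho
      rcases Sym2.eq_iff.1 he with ⟨rfl, rfl⟩ | ⟨rfl, rfl⟩
      · exact ho hk
      · have hb := ho (by rw [P.symm _ _ h, Walk.length_reverse]; exact hk)
        apply Subtype.ext
        rw [P.symm _ _ hne, Q.symm _ _ hne, hb]
  have hpath : P.path = Q.path := by
    funext u v h
    exact key _ u v h le_rfl
  cases P
  cases Q
  congr

end Midpoints

section Counting

open Finset

variable {V : Type*} [Fintype V] [DecidableEq V] {G : SimpleGraph V}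

/-- The number of times each pair occurs when every chosen path is split at its designated
vertex. -/
noncomputable def splitCount (P : PathSystem G) (f : VertexPair V) : ℕ :=
  ∑ e : VertexPair V, ((if s((Quot.out e.1).1, P.pairMid e) = f.1 then 1 else 0) +
    (if s(P.pairMid e, (Quot.out e.1).2) = f.1 then 1 else 0))

theorem sum_pair_ite_mul {D : Sym2 V → ℝ} (hD : ∀ e : Sym2 V, e.IsDiag → D e = 0)
    (e : Sym2 V) :
    ∑ f : VertexPair V, (if e = f.1 then (1 : ℝ) else 0) * D f.1 = D e := by
  by_cases he : e.IsDiag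
  · rw [hD e he]
    refine sum_eq_zero fun f _ => ?_
    rw [if_neg, zero_mul]
    rintro rfl
    exact f.2 he
  · rw [sum_eq_single (⟨e, he⟩ : VertexPair V)]
    · simp
    · intro f _ hf
      rw [if_neg, zero_mul]
      rintro rfl
      exact hf rfl
    · simp

theorem sum_splitCount_mul (P : PathSystem G) {D : Sym2 V → ℝ}
    (hD : ∀ e : Sym2 V, e.IsDiag → D e = 0) :
    ∑ f : VertexPair V, (P.splitCount f : ℝ) * D f.1 =
      ∑ e : VertexPair V, (D s((Quot.out e.1).1, P.pairMid e) +
        D s(P.pairMid e, (Quot.out e.1).2)) := by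
  unfold splitCount
  push_cast
  simp_rw [sum_mul]
  rw [sum_comm]
  refine sum_congr rfl fun e _ => ?_
  simp_rw [add_mul]
  rw [sum_add_distrib, sum_pair_ite_mul hD, sum_pair_ite_mul hD]

theorem sum_splitCount_le (P : PathSystem G) :
    ∑ f, P.splitCount f ≤ 2 * Fintype.card (VertexPair V) := by
  have hone : ∀ e : Sym2 V, ∑ f : VertexPair V, (if e = f.1 then 1 else 0) ≤ 1 := by
    intro e
    rw [← card_filter]
    refine card_le_one.2 fun a ha b hb => Subtype.ext ?_
    rw [← (mem_filter.1 ha).2, ← (mem_filter.1 hb).2]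
  unfold splitCount
  rw [sum_comm]
  calc _ ≤ ∑ _e : VertexPair V, 2 := sum_le_sum fun e _ => by
        rw [sum_add_distrib]
        exact Nat.add_le_add (hone _) (hone _)
    _ = _ := by simp [mul_comm]

theorem IsStrictWeight.mid_mem_of_splitCount_eq {P Q : PathSystem G} {w : Sym2 V → ℝ}
    (hw : P.IsStrictWeight w) (h : P.splitCount = Q.splitCount) (e : VertexPair V) :
    Q.pairMid e ∈ (P.pairPath e).val.support := by
  let D : Sym2 V → ℝ := Sym2.lift ⟨P.pdist w, P.pdist_comm w⟩
  have hD : ∀ e : Sym2 V, e.IsDiag → D e = 0 := by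
    intro e
    induction e with | _ x y
    intro hxy
    obtain rfl : x = y := hxy
    exact P.pdist_self w x
  have hP := P.sum_splitCount_mul hD
  have hQ := Q.sum_splitCount_mul hD
  rw [h, hQ] at hP
  by_contra hmem
  refine (sum_lt_sum (fun i _ => ?_) ⟨e, mem_univ e, ?_⟩).ne' hP
  · refine (hw.pdist_eq i.out_ne (P.mid_mem _ _ i.out_ne)).symm.trans_le ?_
    by_cases hi : Q.pairMid i ∈ (P.pairPath i).val.support
    · exact (hw.pdist_eq i.out_ne hi).le
    · exact (hw.pdist_lt i.out_ne hi).le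
  · refine (hw.pdist_eq e.out_ne (P.mid_mem _ _ e.out_ne)).symm.trans_lt ?_
    exact hw.pdist_lt e.out_ne hmem

theorem StrictlyMetric.eq_of_splitCount_eq {P Q : PathSystem G} (hP : P.StrictlyMetric)
    (hQ : Q.StrictlyMetric) (h : P.splitCount = Q.splitCount) : P = Q := by
  obtain ⟨w, hw⟩ := hP
  obtain ⟨w', hw'⟩ := hQ
  have hw : P.IsStrictWeight w := hw
  have hw' : Q.IsStrictWeight w' := hw'
  exact path_ext_of_mid hw.consistent hw'.consistent
    (hw'.mid_mem_of_splitCount_eq h.symm) (hw.mid_mem_of_splitCount_eq h)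

/-- The functions to `ℕ` whose sum is at most `s`. -/
def boundedSum (ι : Type*) [Fintype ι] [DecidableEq ι] (s : ℕ) : Finset (ι → ℕ) :=
  (Fintype.piFinset fun _ => range (s + 1)).filter fun f => ∑ i, f i ≤ s

theorem mem_boundedSum {ι : Type*} [Fintype ι] [DecidableEq ι] {s : ℕ} {f : ι → ℕ} :
    f ∈ boundedSum ι s ↔ ∑ i, f i ≤ s := by
  simp only [boundedSum, mem_filter, Fintype.mem_piFinset, mem_range, and_iff_right_iff_imp]
  intro h i
  exact Nat.lt_succ_of_le ((single_le_sum (fun _ _ => Nat.zero_le _) (mem_univ i)).trans h)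

theorem card_boundedSum_le (ι : Type*) [Fintype ι] [DecidableEq ι] :
    (#(boundedSum ι (2 * Fintype.card ι)) : ℝ) ≤ (27 / 4) ^ Fintype.card ι := by
  set N := Fintype.card ι
  have hgeom : ∑ k ∈ range (2 * N + 1), (2 / 3 : ℝ) ^ k ≤ 3 := by
    rw [geom_sum_eq (by norm_num), div_le_iff_of_neg (by norm_num)]
    have : (0 : ℝ) ≤ (2 / 3) ^ (2 * N + 1) := by positivity
    linarith
  have hmul : (#(boundedSum ι (2 * N)) : ℝ) * (2 / 3) ^ (2 * N) ≤ 3 ^ N :=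
    calc (#(boundedSum ι (2 * N)) : ℝ) * (2 / 3) ^ (2 * N)
        = ∑ _f ∈ boundedSum ι (2 * N), (2 / 3 : ℝ) ^ (2 * N) := by simp
      _ ≤ ∑ f ∈ boundedSum ι (2 * N), ∏ i, (2 / 3 : ℝ) ^ f i := by
          refine sum_le_sum fun f hf => ?_
          rw [prod_pow_eq_pow_sum]
          exact pow_le_pow_of_le_one (by norm_num) (by norm_num) (mem_boundedSum.1 hf)
      _ ≤ ∑ f ∈ Fintype.piFinset fun _ : ι => range (2 * N + 1), ∏ i, (2 / 3 : ℝ) ^ f i :=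
          sum_le_sum_of_subset_of_nonneg (filter_subset _ _) fun _ _ _ => by positivity
      _ = (∑ k ∈ range (2 * N + 1), (2 / 3 : ℝ) ^ k) ^ N := by
          rw [sum_prod_piFinset]
          simp [N]
      _ ≤ 3 ^ N := by
          gcongr
  have hpos : (0 : ℝ) < (2 / 3) ^ (2 * N) := by positivity
  refine le_of_mul_le_mul_right (hmul.trans_eq ?_) hpos
  rw [pow_mul, ← mul_pow]
  norm_num

theorem card_strictlyMetric_le (G : SimpleGraph V) :
    (Nat.card {P : PathSystem G // P.StrictlyMetric} : ℝ) ≤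
      (27 / 4) ^ (Fintype.card V).choose 2 := by
  let F : {P : PathSystem G // P.StrictlyMetric} →
      boundedSum (VertexPair V) (2 * Fintype.card (VertexPair V)) :=
    fun P => ⟨P.1.splitCount, mem_boundedSum.2 P.1.sum_splitCount_le⟩
  have hF : Function.Injective F := fun P Q h =>
    Subtype.ext (P.2.eq_of_splitCount_eq Q.2 (congrArg Subtype.val h))
  have hcard := Nat.card_le_card_of_injective F hF
  rw [Nat.card_eq_fintype_card (α := boundedSum _ _), Fintype.card_coe] at hcard
  rw [← Sym2.card_subtype_not_diag]
  exact (Nat.cast_le.2 hcard).trans (card_boundedSum_le _)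

end Counting

end PathSystem

theorem count_strictly_metric_upper :
    ∀ ε : ℝ, 0 < ε → ∃ N : ℕ, ∀ n : ℕ, N ≤ n →
      (Nat.card {P : PathSystem (completeGraph (Fin n)) // P.StrictlyMetric} : ℝ) ≤
        (2 : ℝ) ^ ((1.38 + ε) * (n : ℝ) ^ 2) := by
  intro ε hε
  refine ⟨0, fun n _ => (PathSystem.card_strictlyMetric_le _).trans ?_⟩
  have hbase : (27 / 4 : ℝ) ≤ 2 ^ (2.76 : ℝ) := by
    refine le_of_pow_le_pow_left₀ (n := 25) (by norm_num) (by positivity) ?_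
    rw [← Real.rpow_natCast (2 ^ (2.76 : ℝ)), ← Real.rpow_mul (by norm_num)]
    norm_num
  have hchoose : ((n.choose 2 : ℕ) : ℝ) ≤ (n : ℝ) ^ 2 / 2 := by
    rw [Nat.cast_choose_two]
    nlinarith [(Nat.cast_nonneg n : (0 : ℝ) ≤ n)]
  rw [Fintype.card_fin]
  calc (27 / 4 : ℝ) ^ n.choose 2 ≤ (2 ^ (2.76 : ℝ)) ^ n.choose 2 := by gcongr
    _ = 2 ^ ((2.76 : ℝ) * (n.choose 2 : ℕ)) := by
        rw [Real.rpow_mul (by norm_num), Real.rpow_natCast]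
    _ ≤ 2 ^ ((1.38 + ε) * (n : ℝ) ^ 2) := by
        refine Real.rpow_le_rpow_of_exponent_le (by norm_num) ?_
        nlinarith [mul_nonneg hε.le (sq_nonneg (n : ℝ))]
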